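/- Let κ₁ ≤ κ₂ ≤ ... ≤ κₙ be a non-decreasing finite sequence of uncountable regular cardinals, for each i let Uᵢ be a normal measure on κᵢ, and let Aᵢ ∈ Uᵢ. Let B be an arbitrary set and let F be a function assigning to every strictly increasing n-tuple ⟨a₁,...,aₙ⟩ with aᵢ ∈ Aᵢ an element of B. Then there exist sets Hᵢ ⊆ Aᵢ with Hᵢ ∈ Uᵢ and a set of coordinates I ⊆ {1,...,n} such that for any two strictly increasing n-tuples η = ⟨η₁,...,ηₙ⟩ and ξ = ⟨ξ₁,...,ξₙ⟩ with ηᵢ, ξᵢ ∈ Hᵢ, one has F(η) = F(ξ) if and only if ηᵢ = ξᵢ for every i ∈ I. -/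

import Mathlib

/-- `κ` is (the ordinal of) an uncountable regular cardinal. -/
def IsUncountableRegularCard (κ : Ordinal) : Prop :=
  Cardinal.aleph0 < κ.card ∧ κ.card.IsRegular ∧ κ.card.ord = κ

/-- `U` is a normal measure on `κ`: an ultrafilter on the subsets of `κ` (identified with
`Set.Iio κ`) which is `κ`-complete, closed under diagonal intersections, and nonprincipal. -/
def IsNormalMeasure (κ : Ordinal) (U : Set (Set Ordinal)) : Prop :=
  (∀ A ∈ U, A ⊆ Set.Iio κ) ∧
  Set.Iio κ ∈ U ∧
  (∅ : Set Ordinal) ∉ U ∧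
  (∀ A B : Set Ordinal, A ∈ U → A ⊆ B → B ⊆ Set.Iio κ → B ∈ U) ∧
  (∀ A : Set Ordinal, A ⊆ Set.Iio κ → A ∈ U ∨ Set.Iio κ \ A ∈ U) ∧
  (∀ γ, γ < κ → ∀ s : Ordinal → Set Ordinal, (∀ i, i < γ → s i ∈ U) →
    (Set.Iio κ ∩ ⋂ i ∈ Set.Iio γ, s i) ∈ U) ∧
  (∀ s : Ordinal → Set Ordinal, (∀ α, α < κ → s α ∈ U) →
    {β | β < κ ∧ ∀ α, α < β → β ∈ s α} ∈ U) ∧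
  (∀ α : Ordinal, ({α} : Set Ordinal) ∉ U)

def NrmU (V : Ultrafilter Ordinal) : Prop :=
  ∀ P : Ordinal → Ordinal → Prop, (∀ α, ∀ᶠ x in V, P α x) → ∀ᶠ x in V, ∀ α, α < x → P α x

theorem NrmU.tuple {V : Ultrafilter Ordinal} (hV : NrmU V) (m : ℕ) :
    ∀ P : (Fin m → Ordinal) → Ordinal → Prop, (∀ c, ∀ᶠ x in V, P c x) →
      ∀ᶠ x in V, ∀ c, (∀ i, c i < x) → P c x := by
  induction m with
  | zero =>
    intro P h
    filter_upwards [h Fin.elim0] with x hx c _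
    rwa [Subsingleton.elim c Fin.elim0]
  | succ m ih =>
    intro P h
    have h1 : ∀ α, ∀ᶠ x in V, ∀ c : Fin m → Ordinal, (∀ i, c i < x) →
        P (Fin.cons α c : Fin (m+1) → Ordinal) x := by
      intro α
      exact ih (fun c x => P (Fin.cons α c : Fin (m+1) → Ordinal) x) (fun c => h _)
    filter_upwards [hV _ h1] with x hx c hc
    have := hx (c 0) (hc 0) (Fin.tail c) (fun i => hc i.succ)
    rwa [Fin.cons_self_tail] at this

theorem homog_aux (n : ℕ) : ∀ (V : Fin n → Ultrafilter Ordinal), (∀ i, NrmU (V i)) →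
    ∀ P : (Fin n → Ordinal) → Prop, ∃ (H : Fin n → Set Ordinal) (Q : Prop), (∀ i, H i ∈ V i) ∧
      ∀ η : Fin n → Ordinal, StrictMono η → (∀ i, η i ∈ H i) → (P η ↔ Q) := by
  induction n with
  | zero =>
    intro V hV P
    refine ⟨fun _ => Set.univ, P Fin.elim0, fun i => i.elim0, fun η _ _ => ?_⟩
    rw [Subsingleton.elim η Fin.elim0]
  | succ n ih =>
    intro V hV P
    obtain ⟨H, Q, hH, hQ⟩ := ih (fun i => V i.castSucc) (fun i => hV _)
      (fun a => ∀ᶠ x in V (Fin.last n), P (Fin.snoc a x : Fin (n+1) → Ordinal))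
    have hD := (hV (Fin.last n)).tuple n
      (fun a x => P (Fin.snoc a x : Fin (n+1) → Ordinal) ↔
        ∀ᶠ x in V (Fin.last n), P (Fin.snoc a x : Fin (n+1) → Ordinal)) (by
        intro a
        by_cases h : ∀ᶠ x in V (Fin.last n), P (Fin.snoc a x : Fin (n+1) → Ordinal)
        · filter_upwards [h] with x hx
          exact ⟨fun _ => h, fun _ => hx⟩
        · filter_upwards [Ultrafilter.eventually_not.2 h] with x hx
          exact ⟨fun h' => absurd h' hx, fun h' => absurd h' h⟩)
    refine ⟨Fin.snoc (α := fun _ => Set Ordinal) H {x | ∀ c : Fin n → Ordinal, (∀ i, c i < x) →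
        (P (Fin.snoc c x : Fin (n+1) → Ordinal) ↔
        ∀ᶠ x in V (Fin.last n), P (Fin.snoc c x : Fin (n+1) → Ordinal))}, Q, ?_, ?_⟩
    · intro i
      refine Fin.lastCases ?_ (fun i => ?_) i
      · rw [Fin.snoc_last]; exact hD
      · simpa using hH i
    · intro η hη hm
      have h1 := hm (Fin.last n)
      rw [Fin.snoc_last] at h1
      have h2 := h1 (Fin.init η) (fun i => hη (Fin.castSucc_lt_last i))
      rw [Fin.snoc_init_self] at h2
      rw [h2]
      refine hQ (Fin.init η) (fun i j hij => hη (Fin.castSucc_lt_castSucc_iff.2 hij)) (fun i => ?_)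
      have := hm i.castSucc
      rwa [Fin.snoc_castSucc] at this

theorem main_aux (n : ℕ) : ∀ (V : Fin n → Ultrafilter Ordinal), (∀ i, NrmU (V i)) →
    ∀ R : Setoid (Fin n → Ordinal), ∃ (H : Fin n → Set Ordinal) (I : Set (Fin n)),
      (∀ i, H i ∈ V i) ∧
      ∀ η ξ : Fin n → Ordinal, StrictMono η → (∀ i, η i ∈ H i) →
        StrictMono ξ → (∀ i, ξ i ∈ H i) → (R η ξ ↔ ∀ i ∈ I, η i = ξ i) := by
  induction n with
  | zero =>
    intro V hV R
    refine ⟨fun _ => Set.univ, ∅, fun i => i.elim0, fun η ξ _ _ _ _ => ?_⟩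
    rw [Subsingleton.elim η ξ]
    simp [R.refl ξ]
  | succ n ih =>
    intro V hV R
    set W := V (Fin.last n) with hW
    have hWn : NrmU W := hV _
    set T : (Fin n → Ordinal) → Ordinal → (Fin n → Ordinal) → Ordinal → Prop :=
      fun a x b y => R (Fin.snoc a x : Fin (n+1) → Ordinal) (Fin.snoc b y : Fin (n+1) → Ordinal)
      with hT
    have Tr : ∀ a x, T a x a x := fun a x => R.refl _
    have Ts : ∀ {a x b y}, T a x b y → T b y a x := fun h => R.symm h
    have Tt : ∀ {a x b y c z}, T a x b y → T b y c z → T a x c z := fun h h' => R.trans h h'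
    let C : (Fin n → Ordinal) → Prop := fun a => ∃ x, ∀ᶠ y in W, T a x a y
    obtain ⟨H0, Q, hH0, hQ⟩ := homog_aux n (fun i => V i.castSucc) (fun i => hV _) C
    let R' : Setoid (Fin n → Ordinal) :=
      { r := fun a b => ∀ᶠ x in W, T a x b x
        iseqv := ⟨fun a => Filter.Eventually.of_forall (fun x => Tr a x),
          fun h => h.mono (fun x hx => Ts hx),
          fun h h' => (h.and h').mono (fun x hx => Tt hx.1 hx.2)⟩ }
    obtain ⟨H1, I, hH1, hI⟩ := ih (fun i => V i.castSucc) (fun i => hV _) R'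
    have D1 : ∀ᶠ z in W, ∀ a : Fin n → Ordinal, (∀ i, a i < z) → ∀ b : Fin n → Ordinal,
        (∀ i, b i < z) → (T a z b z ↔ R' a b) := by
      refine hWn.tuple n _ (fun a => hWn.tuple n _ (fun b => ?_))
      by_cases h : ∀ᶠ x in W, T a x b x
      · filter_upwards [h] with x hx
        exact ⟨fun _ => h, fun _ => hx⟩
      · filter_upwards [Ultrafilter.eventually_not.2 h] with x hx
        exact ⟨fun h' => absurd h' hx, fun h' => absurd h' h⟩
    have D2 : ∀ᶠ y in W, ∀ a : Fin n → Ordinal, (∀ i, a i < y) → ∀ b : Fin n → Ordinal,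
        (∀ i, b i < y) → ∀ x, x < y → ¬ C a → ¬ T a y b x := by
      refine hWn.tuple n _ (fun a => hWn.tuple n _ (fun b => hWn _ (fun x => ?_)))
      by_cases h : ∀ᶠ y in W, T a y b x
      · obtain ⟨y0, hy0⟩ := h.exists
        exact Filter.Eventually.of_forall
          (fun _ hc => absurd ⟨y0, h.mono (fun y hy => Tt hy0 (Ts hy))⟩ hc)
      · filter_upwards [Ultrafilter.eventually_not.2 h] with y hy _
        exact hy
    have D3 : ∃ f : (Fin n → Ordinal) → Ordinal, ∀ᶠ y in W, ∀ a : Fin n → Ordinal,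
        (∀ i, a i < y) → C a → T a (f a) a y := by
      have : ∀ a, ∃ x, C a → ∀ᶠ y in W, T a x a y := by
        intro a
        by_cases h : C a
        · obtain ⟨x, hx⟩ := h
          exact ⟨x, fun _ => hx⟩
        · exact ⟨0, fun h' => absurd h' h⟩
      choose f hf using this
      refine ⟨f, hWn.tuple n _ (fun a => ?_)⟩
      by_cases h : C a
      · exact (hf a h).mono (fun _ hx _ => hx)
      · exact Filter.Eventually.of_forall (fun _ h' => absurd h' h)
    obtain ⟨f, D3⟩ := D3
    have hS := (D1.and (D2.and D3))
    obtain ⟨S, hSW, hS⟩ := hS.exists_mem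
    let H : Fin (n+1) → Set Ordinal :=
      Fin.snoc (α := fun _ => Set Ordinal) (fun i => H0 i ∩ H1 i) S
    refine ⟨H, {i | (i = Fin.last n ∧ ¬ Q) ∨ ∃ j ∈ I, i = Fin.castSucc j}, ?_, ?_⟩
    · intro i
      refine Fin.lastCases ?_ (fun i => ?_) i
      · simpa [H] using hSW
      · simp only [H, Fin.snoc_castSucc]; exact Filter.inter_mem (hH0 i) (hH1 i)
    · intro η ξ hη hηH hξ hξH
      have key : ∀ η : Fin (n+1) → Ordinal, StrictMono η → (∀ i, η i ∈ H i) →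
          StrictMono (Fin.init η : Fin n → Ordinal) ∧ (∀ i, (Fin.init η : Fin n → Ordinal) i ∈ H0 i) ∧
          (∀ i, (Fin.init η : Fin n → Ordinal) i ∈ H1 i) ∧
          (∀ i, (Fin.init η : Fin n → Ordinal) i < η (Fin.last n)) ∧ η (Fin.last n) ∈ S := by
        intro η hη hm
        have hc : ∀ i : Fin n, η i.castSucc ∈ H0 i ∩ H1 i := by
          intro i
          have := hm i.castSucc
          simpa only [H, Fin.snoc_castSucc] using this
        refine ⟨fun i j hij => hη (Fin.castSucc_lt_castSucc_iff.2 hij), fun i => (hc i).1,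
          fun i => (hc i).2, fun i => hη (Fin.castSucc_lt_last i), ?_⟩
        have := hm (Fin.last n)
        simpa only [H, Fin.snoc_last] using this
      obtain ⟨ma, a0, a1, ax, xS⟩ := key η hη hηH
      obtain ⟨mb, b0, b1, bY, yS⟩ := key ξ hξ hξH
      have e : R η ξ ↔ T (Fin.init η) (η (Fin.last n)) (Fin.init ξ) (ξ (Fin.last n)) := by
        simp only [hT, Fin.snoc_init_self]
      have hIab := hI _ _ ma a1 mb b1
      have qa := hQ _ ma a0
      have qb := hQ _ mb b0
      have hcast : (∀ j ∈ I, η j.castSucc = ξ j.castSucc) ↔ R' (Fin.init η) (Fin.init ξ) :=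
        hIab.symm
      rw [e]
      generalize (Fin.init η : Fin n → Ordinal) = a at *
      generalize (Fin.init ξ : Fin n → Ordinal) = b at *
      by_cases hq : Q
      · have e2 : (∀ i ∈ {i | (i = Fin.last n ∧ ¬ Q) ∨ ∃ j ∈ I, i = Fin.castSucc j}, η i = ξ i) ↔
            (∀ j ∈ I, η j.castSucc = ξ j.castSucc) := by
          constructor
          · intro h j hj
            exact h _ (Or.inr ⟨j, hj, rfl⟩)
          · rintro h i (⟨_, h'⟩ | ⟨j, hj, rfl⟩)
            · exact absurd hq h'
            · exact h j hj
        rw [e2, hcast]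
        generalize η (Fin.last n) = x at *
        generalize ξ (Fin.last n) = y at *
        have mS : max x y ∈ S := by
          rcases max_choice x y with h | h <;> rw [h] <;> assumption
        have am : ∀ i, a i < max x y := fun i => lt_max_of_lt_left (ax i)
        have bm : ∀ i, b i < max x y := fun i => lt_max_of_lt_right (bY i)
        have t1 : T a x a (max x y) :=
          Tt (Ts ((hS _ xS).2.2 a ax (qa.2 hq))) ((hS _ mS).2.2 a am (qa.2 hq))
        have t2 : T b y b (max x y) :=
          Tt (Ts ((hS _ yS).2.2 b bY (qb.2 hq))) ((hS _ mS).2.2 b bm (qb.2 hq))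
        rw [← (hS _ mS).1 a am b bm]
        exact ⟨fun h => Tt (Ts t1) (Tt h t2), fun h => Tt t1 (Tt h (Ts t2))⟩
      · have e2 : (∀ i ∈ {i | (i = Fin.last n ∧ ¬ Q) ∨ ∃ j ∈ I, i = Fin.castSucc j}, η i = ξ i) ↔
            η (Fin.last n) = ξ (Fin.last n) ∧ (∀ j ∈ I, η j.castSucc = ξ j.castSucc) := by
          constructor
          · intro h
            exact ⟨h _ (Or.inl ⟨rfl, hq⟩), fun j hj => h _ (Or.inr ⟨j, hj, rfl⟩)⟩
          · rintro ⟨h0, h⟩ i (⟨rfl, _⟩ | ⟨j, hj, rfl⟩)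
            · exact h0
            · exact h j hj
        rw [e2, hcast]
        generalize η (Fin.last n) = x at *
        generalize ξ (Fin.last n) = y at *
        have nca : ¬ C a := fun h => hq (qa.1 h)
        have ncb : ¬ C b := fun h => hq (qb.1 h)
        rcases lt_trichotomy x y with h | h | h
        · refine ⟨fun ht => ?_, fun ht => absurd ht.1 h.ne⟩
          exact absurd (Ts ht)
            ((hS _ yS).2.1 b bY a (fun i => (ax i).trans h) x h ncb)
        · subst h
          rw [(hS _ xS).1 a ax b bY]
          exact ⟨fun h => ⟨rfl, h⟩, fun h => h.2⟩
        · refine ⟨fun ht => ?_, fun ht => absurd ht.1 h.ne'⟩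
          exact absurd ht
            ((hS _ xS).2.1 a ax b (fun i => (bY i).trans h) y h nca)

theorem exists_ultra (κ : Ordinal) (hκ : IsUncountableRegularCard κ) (U : Set (Set Ordinal))
    (hU : IsNormalMeasure κ U) :
    ∃ V : Ultrafilter Ordinal, NrmU V ∧ ∀ S, S ∈ V ↔ Set.Iio κ ∩ S ∈ U := by
  obtain ⟨hsub, htop, hemp, hup, hult, hcomp, hnorm, -⟩ := hU
  have h2 : (2 : Ordinal) < κ := by
    by_contra h
    have h' := Ordinal.card_le_card (not_lt.1 h)
    have := hκ.1.trans_le h'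
    have h3 : (2 : Ordinal).card < Cardinal.aleph0 := by
      simpa using Cardinal.natCast_lt_aleph0 (n := 2)
    exact absurd this h3.not_gt
  have hinter : ∀ A ∈ U, ∀ B ∈ U, A ∩ B ∈ U := by
    intro A hA B hB
    refine hup _ _ (hcomp 2 h2 (fun i => if i = 0 then A else B) ?_) ?_ ?_
    · intro i _
      split_ifs <;> assumption
    · rintro x ⟨_, hx⟩
      simp only [Set.mem_iInter, Set.mem_Iio] at hx
      have h0 := hx 0 (by norm_num)
      have h1 := hx 1 (by norm_num)
      simp at h0 h1
      exact ⟨h0, h1⟩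
    · exact fun x hx => hsub A hA hx.1
  let f : Filter Ordinal :=
    { sets := {S | Set.Iio κ ∩ S ∈ U}
      univ_sets := by simpa using htop
      sets_of_superset := by
        intro A B hA hAB
        exact hup _ _ hA (Set.inter_subset_inter_right _ hAB) Set.inter_subset_left
      inter_sets := by
        intro A B hA hB
        have := hinter _ hA _ hB
        rwa [← Set.inter_inter_distrib_left] at this }
  have hf : ∀ S, S ∈ f ↔ Set.Iio κ ∩ S ∈ U := fun S => Iff.rfl
  have hc : ∀ s, sᶜ ∉ f ↔ s ∈ f := by
    intro s
    rw [hf, hf]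
    constructor
    · intro h
      rcases hult (Set.Iio κ ∩ s) Set.inter_subset_left with h' | h'
      · exact h'
      · refine absurd ?_ h
        rwa [Set.sdiff_self_inter, Set.sdiff_eq] at h'
    · intro h h'
      have := hinter _ h _ h'
      rw [← Set.inter_inter_distrib_left] at this
      simp at this
      exact hemp this
  refine ⟨Ultrafilter.ofComplNotMemIff f hc, ?_, fun S => Iff.rfl⟩
  intro P hP
  change _ ∈ f
  rw [hf]
  refine hup _ _ (hnorm (fun α => Set.Iio κ ∩ {x | P α x}) (fun α _ => hP α)) ?_
    Set.inter_subset_left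
  rintro x ⟨hx, h⟩
  exact ⟨hx, fun α hα => (h α hα).2⟩

/-- Lemma 2.3 (important coordinates): for any function `F` on the increasing products of
measure-one sets into an arbitrary set `B`, there are measure-one subsets `Hᵢ ⊆ Aᵢ` and a set
`I` of coordinates such that on increasing tuples from `∏ᵢ Hᵢ`, `F`-values agree exactly when
the tuples agree on all coordinates in `I`. -/
theorem stmt_2 (n : ℕ) (hn : 0 < n) (κ : Fin n → Ordinal) (hκmono : Monotone κ)
    (hκ : ∀ i, IsUncountableRegularCard (κ i))
    (U : Fin n → Set (Set Ordinal)) (hU : ∀ i, IsNormalMeasure (κ i) (U i))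
    (A : Fin n → Set Ordinal) (hA : ∀ i, A i ∈ U i)
    (B : Type*) (F : (Fin n → Ordinal) → B) :
    ∃ (H : Fin n → Set Ordinal) (I : Set (Fin n)),
      (∀ i, H i ⊆ A i) ∧ (∀ i, H i ∈ U i) ∧
      ∀ η ξ : Fin n → Ordinal, StrictMono η → (∀ i, η i ∈ H i) →
        StrictMono ξ → (∀ i, ξ i ∈ H i) →
        (F η = F ξ ↔ ∀ i ∈ I, η i = ξ i) := by
  choose V hVn hV using fun i => exists_ultra (κ i) (hκ i) (U i) (hU i)
  obtain ⟨H, I, hH, hI⟩ := main_aux n V hVn (Setoid.ker F)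
  refine ⟨fun i => Set.Iio (κ i) ∩ (A i ∩ H i), I, fun i x hx => hx.2.1, fun i => ?_, ?_⟩
  · rw [← hV i]
    refine Filter.inter_mem ?_ (hH i)
    change _ ∈ V i
    rw [hV i, Set.inter_eq_right.2 ((hU i).1 _ (hA i))]
    exact hA i
  · intro η ξ hη hηH hξ hξH
    exact hI η ξ hη (fun i => (hηH i).2.2) hξ (fun i => (hξH i).2.2)
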